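/- If $w = u \prod_{j=1}^N (Mh_j)^{-\alpha_j}$ with $u \in A_1$, $h_j \in L^1_{loc}$ (and $0 < Mh_j < \infty$ a.e.), and $\alpha_j \ge 0$ for all $j$, then $w \in A_\infty$ and $[w]_{RH_\infty^1} \lesssim [u]_{A_1}$, with implicit constant depending only on $n$, $N$, and the exponents $\alpha_j$. -/

import Mathlib

open MeasureTheory ENNReal Set Filter

noncomputable section

/-- The measure with density `w` with respect to the ambient volume. -/
def wMeasure {α : Type*} [MeasureSpace α] (w : α → ℝ) : Measure α :=
  (volume : Measure α).withDensity fun x => ENNReal.ofReal (w x)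

/-- The weak Lorentz `L^{q,∞}(μ)` quasi-norm. -/
def wLorentz {α E : Type*} [MeasurableSpace α] [Norm E] (q : ℝ) (μ : Measure α)
    (g : α → E) : ℝ≥0∞ :=
  ⨆ (t : ℝ) (_ : 0 < t), ENNReal.ofReal t * μ {x | t < ‖g x‖} ^ (1 / q)

/-- The weak Lorentz `L^{q,∞}(μ)` quasi-norm, for `ℝ≥0∞`-valued functions. -/
def wLorentzE {α : Type*} [MeasurableSpace α] (q : ℝ) (μ : Measure α)
    (g : α → ℝ≥0∞) : ℝ≥0∞ :=
  ⨆ (t : ℝ) (_ : 0 < t), ENNReal.ofReal t * μ {x | ENNReal.ofReal t < g x} ^ (1 / q)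

/-- The Lorentz `L^{p,r}(μ)` quasi-norm (computed via the distribution function). -/
def lorentz {α E : Type*} [MeasurableSpace α] [Norm E] (p r : ℝ) (μ : Measure α)
    (g : α → E) : ℝ≥0∞ :=
  (∫⁻ t in Set.Ioi (0 : ℝ), ENNReal.ofReal (t ^ (r - 1)) * μ {x | t < ‖g x‖} ^ (r / p)) ^ (1 / r)

/-- A weight: a locally integrable, a.e. positive function. -/
def IsWeight {α : Type*} [MeasureSpace α] [TopologicalSpace α] (w : α → ℝ) : Prop :=
  LocallyIntegrable w volume ∧ ∀ᵐ x : α ∂volume, 0 < w x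

abbrev Rn (n : ℕ) : Type := Fin n → ℝ

/-- The axis-parallel closed cube with center `c` and half side-length `r`. -/
def cube {n : ℕ} (c : Rn n) (r : ℝ) : Set (Rn n) := {x | ∀ i, |x i - c i| ≤ r}

/-- The Hardy–Littlewood maximal operator over cubes. -/
def maxOp {n : ℕ} (f : Rn n → ℝ) (x : Rn n) : ℝ≥0∞ :=
  ⨆ (c : Rn n) (r : ℝ) (_ : 0 < r) (_ : x ∈ cube c r),
    (∫⁻ y in cube c r, ENNReal.ofReal |f y|) / volume (cube c r)

/-- The `A₁` constant: the least `C` with `Mu ≤ C u` a.e. -/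
def A1Const {n : ℕ} (u : Rn n → ℝ) : ℝ≥0∞ :=
  sInf {C : ℝ≥0∞ | ∀ᵐ x : Rn n ∂volume, maxOp u x ≤ C * ENNReal.ofReal (u x)}

def MemA1 {n : ℕ} (u : Rn n → ℝ) : Prop := IsWeight u ∧ A1Const u < ⊤

/-- The `RH∞` constant `sup_Q (ess sup_Q v) |Q| / v(Q)`. -/
def RHinfConst {n : ℕ} (v : Rn n → ℝ) : ℝ≥0∞ :=
  ⨆ (c : Rn n) (r : ℝ) (_ : 0 < r),
    essSup (fun x => ENNReal.ofReal (v x)) (volume.restrict (cube c r)) * volume (cube c r)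
      / wMeasure v (cube c r)

/-- The Fujii–Wilson `A∞` constant. -/
def FWConst {n : ℕ} (w : Rn n → ℝ) : ℝ≥0∞ :=
  ⨆ (c : Rn n) (r : ℝ) (_ : 0 < r),
    (∫⁻ x in cube c r, maxOp ((cube c r).indicator w) x) / wMeasure w (cube c r)

/-- The Muckenhoupt `A_q` constant, `q > 1`. -/
def AqConst {n : ℕ} (q : ℝ) (w : Rn n → ℝ) : ℝ≥0∞ :=
  ⨆ (c : Rn n) (r : ℝ) (_ : 0 < r),
    (wMeasure w (cube c r) / volume (cube c r)) *
      ((∫⁻ x in cube c r, ENNReal.ofReal (w x ^ (1 - q / (q - 1)))) / volume (cube c r)) ^ (q - 1)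

/-- Membership in `A∞ = ⋃_{q>1} A_q`. -/
def MemAinf {n : ℕ} (w : Rn n → ℝ) : Prop := ∃ q : ℝ, 1 < q ∧ AqConst q w < ⊤

/-- The restricted `A_q^𝓡` constant. -/
def AqRConst {n : ℕ} (q : ℝ) (w : Rn n → ℝ) : ℝ≥0∞ :=
  ⨆ (c : Rn n) (r : ℝ) (_ : 0 < r) (E : Set (Rn n)) (_ : MeasurableSet E)
    (_ : E ⊆ cube c r) (_ : 0 < volume E),
    volume E / volume (cube c r) * (wMeasure w (cube c r) / wMeasure w E) ^ (1 / q)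

/-- The constant `[w]_{RH∞¹} = inf {[u]_{A₁}[v]_{RH∞} : w = uv}`. -/
def RH1Const {n : ℕ} (w : Rn n → ℝ) : ℝ≥0∞ :=
  sInf {C : ℝ≥0∞ | ∃ u v : Rn n → ℝ, (∀ x, w x = u x * v x) ∧ MemA1 u ∧ IsWeight v ∧
    RHinfConst v < ⊤ ∧ C = A1Const u * RHinfConst v}

/-- `S f = (M(|Tf|^{1/2}))²`. -/
def Sop {n : ℕ} (T : (Rn n → ℝ) → Rn n → ℝ) (f : Rn n → ℝ) (x : Rn n) : ℝ≥0∞ :=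
  maxOp (fun y => |T f y| ^ ((2 : ℝ)⁻¹)) x ^ (2 : ℝ)

/-- Condition (C): for some `p₀` and increasing `φ`,
`∫ (Sf)^{p₀} w ≤ φ([w]_{A∞}) ∫ (Mf)^{p₀} w` for all `w ∈ A∞`. -/
def ConditionC {n : ℕ} (T : (Rn n → ℝ) → Rn n → ℝ) : Prop :=
  ∃ p0 : ℝ, 0 < p0 ∧ ∃ φ : ℝ≥0∞ → ℝ≥0∞, Monotone φ ∧
    ∀ w : Rn n → ℝ, IsWeight w → MemAinf w → ∀ f : Rn n → ℝ, Measurable f →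
      (∫⁻ x, Sop T f x ^ p0 * ENNReal.ofReal (w x)) < ⊤ →
      (∫⁻ x, Sop T f x ^ p0 * ENNReal.ofReal (w x)) ≤
        φ (FWConst w) * ∫⁻ x, maxOp f x ^ p0 * ENNReal.ofReal (w x)


section Cubes

variable {n : ℕ}

lemma cube_eq_closedBall (c : Rn n) {r : ℝ} (hr : 0 ≤ r) : cube c r = Metric.closedBall c r := by
  ext x
  simp [cube, Metric.mem_closedBall, dist_pi_le_iff hr, Real.dist_eq]

lemma volume_cube (c : Rn n) {r : ℝ} (hr : 0 ≤ r) :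
    volume (cube c r) = ENNReal.ofReal ((2 * r) ^ n) := by
  rw [cube_eq_closedBall c hr, Real.volume_pi_closedBall c hr, Fintype.card_fin]

lemma volume_cube_mul (c : Rn n) {k r : ℝ} (hk : 0 ≤ k) (hr : 0 ≤ r) :
    volume (cube c (k * r)) = ENNReal.ofReal (k ^ n) * volume (cube c r) := by
  rw [volume_cube c hr, volume_cube c (mul_nonneg hk hr), ← ENNReal.ofReal_mul (by positivity)]
  congr 1
  rw [← mul_pow]
  ring

lemma volume_cube_ne_zero (c : Rn n) {r : ℝ} (hr : 0 < r) : volume (cube c r) ≠ 0 := by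
  rw [volume_cube c hr.le]
  have : 0 < (2 * r) ^ n := by positivity
  simpa using this

lemma volume_cube_ne_top (c : Rn n) {r : ℝ} (hr : 0 ≤ r) : volume (cube c r) ≠ ⊤ := by
  rw [volume_cube c hr]
  exact ENNReal.ofReal_ne_top

lemma measurableSet_cube (c : Rn n) {r : ℝ} (hr : 0 ≤ r) : MeasurableSet (cube c r) := by
  rw [cube_eq_closedBall c hr]
  exact measurableSet_closedBall

lemma cube_subset_cube_three_mul {c c' x : Rn n} {r r' : ℝ} (hx : x ∈ cube c r)
    (hx' : x ∈ cube c' r') (hr : r ≤ r') : cube c r ⊆ cube c' (3 * r') := by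
  intro y hy i
  have h1 := abs_le.1 (hx i)
  have h2 := abs_le.1 (hx' i)
  have h3 := abs_le.1 (hy i)
  rw [abs_le]
  constructor <;> linarith

lemma cube_mono (c : Rn n) {r r' : ℝ} (h : r ≤ r') : cube c r ⊆ cube c r' :=
  fun _ hx i => (hx i).trans h

lemma le_maxOp (f : Rn n → ℝ) {c x : Rn n} {r : ℝ} (hr : 0 < r) (hx : x ∈ cube c r) :
    (∫⁻ y in cube c r, ENNReal.ofReal |f y|) / volume (cube c r) ≤ maxOp f x :=
  le_iSup_of_le c <| le_iSup_of_le r <| le_iSup_of_le hr <| le_iSup_of_le hx le_rfl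

lemma lt_maxOp_iff {f : Rn n → ℝ} {x : Rn n} {t : ℝ≥0∞} :
    t < maxOp f x ↔ ∃ (c : Rn n) (r : ℝ), 0 < r ∧ x ∈ cube c r ∧
      t < (∫⁻ y in cube c r, ENNReal.ofReal |f y|) / volume (cube c r) := by
  simp only [maxOp, lt_iSup_iff, exists_prop]

lemma lowerSemicontinuous_maxOp (f : Rn n → ℝ) : LowerSemicontinuous (maxOp f) := by
  intro x t ht
  obtain ⟨c, r, hr, hx, h⟩ := lt_maxOp_iff.1 ht
  have hcont : Tendsto (fun s : ℝ => (∫⁻ y in cube c r, ENNReal.ofReal |f y|) /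
      ENNReal.ofReal ((2 * s) ^ n)) (nhdsWithin r (Ioi r)) (nhds ((∫⁻ y in cube c r,
        ENNReal.ofReal |f y|) / ENNReal.ofReal ((2 * r) ^ n))) := by
    refine ENNReal.Tendsto.const_div ?_ (Or.inl ENNReal.ofReal_ne_top)
    refine ENNReal.tendsto_ofReal (Tendsto.mono_left ?_ nhdsWithin_le_nhds)
    exact ((continuous_const.mul continuous_id).pow n).tendsto r
  rw [volume_cube c hr.le] at h
  obtain ⟨s, hs, hrs⟩ := ((hcont.eventually (lt_mem_nhds h)).and self_mem_nhdsWithin).exists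
  have hrs : r < s := hrs
  have h0 : 0 < s := hr.trans hrs
  have hnear : ∀ᶠ y in nhds x, y ∈ cube c s := by
    filter_upwards [Metric.ball_mem_nhds x (sub_pos.2 hrs)] with y hy i
    have h1 := hx i
    have h2 : |y i - x i| < s - r := by
      rw [← Real.dist_eq]
      exact (dist_le_pi_dist y x i).trans_lt hy
    have h3 := abs_sub_le (y i) (x i) (c i)
    linarith
  filter_upwards [hnear] with y hy
  refine lt_maxOp_iff.2 ⟨c, s, h0, hy, hs.trans_le ?_⟩
  rw [volume_cube c h0.le]
  gcongr
  exact cube_mono c hrs.le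

lemma measurable_maxOp (f : Rn n → ℝ) : Measurable (maxOp f) :=
  (lowerSemicontinuous_maxOp f).measurable

/-- A cube on which `f` has average above `K` times the infimum of `M f` over a cube it meets is
smaller than the latter, if `K ≥ 3 ^ n`. -/
lemma radius_lt_of_lt_average {f : Rn n → ℝ} {c c' x : Rn n} {r r' : ℝ}
    (hr' : 0 < r') (hx : x ∈ cube c r) (hx' : x ∈ cube c' r') {K : ℝ≥0∞}
    (hK : ENNReal.ofReal (3 ^ n) ≤ K)
    (h : K * (⨅ y ∈ cube c r, maxOp f y) <
      (∫⁻ y in cube c' r', ENNReal.ofReal |f y|) / volume (cube c' r')) : r' < r := by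
  by_contra! hle
  refine h.not_ge ?_
  have h3 : (∫⁻ y in cube c' (3 * r'), ENNReal.ofReal |f y|) / volume (cube c' (3 * r')) ≤
      ⨅ y ∈ cube c r, maxOp f y :=
    le_iInf₂ fun y hy => le_maxOp f (by positivity) (cube_subset_cube_three_mul hx hx' hle hy)
  have hpos : ENNReal.ofReal (3 ^ n) ≠ 0 := by simp
  refine le_trans ?_ (mul_le_mul' hK h3)
  rw [volume_cube_mul c' (by norm_num) hr'.le, ← mul_div_assoc,
    ENNReal.mul_div_mul_left _ _ hpos ENNReal.ofReal_ne_top]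
  gcongr
  exact cube_mono c' (by linarith)

lemma weak_type_large (f : Rn n → ℝ) (c : Rn n) {r : ℝ} (hr : 0 < r) {K : ℝ≥0∞}
    (hK : ENNReal.ofReal (3 ^ n) ≤ K)
    (h0 : (⨅ y ∈ cube c r, maxOp f y) ≠ 0) (htop : (⨅ y ∈ cube c r, maxOp f y) ≠ ⊤) :
    K * volume {x ∈ cube c r | K * (⨅ y ∈ cube c r, maxOp f y) < maxOp f x} ≤
      ENNReal.ofReal (15 ^ n) * volume (cube c r) := by
  set lam := ⨅ y ∈ cube c r, maxOp f y with hlam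
  let T : Set (Rn n × ℝ) := {p | 0 < p.2 ∧ p.2 < r ∧ (∃ x ∈ cube c r, x ∈ cube p.1 p.2) ∧
    K * lam < (∫⁻ y in cube p.1 p.2, ENNReal.ofReal |f y|) / volume (cube p.1 p.2)}
  obtain ⟨U, hUT, hdisj, hcov⟩ := Vitali.exists_disjoint_subfamily_covering_enlargement_closedBall
    T Prod.fst Prod.snd r (fun p hp => hp.2.1.le) 5 (by norm_num)
  have hball : ∀ p ∈ T, cube p.1 p.2 = Metric.closedBall p.1 p.2 :=
    fun p hp => cube_eq_closedBall _ hp.1.le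
  have hcount : U.Countable := hdisj.countable_of_nonempty_interior fun p hp =>
    ⟨p.1, Metric.ball_subset_interior_closedBall (Metric.mem_ball_self (hUT hp).1)⟩
  have hdisj' : U.PairwiseDisjoint fun p => cube p.1 p.2 := by
    intro p hp q hq hpq
    simpa only [Function.onFun, hball p (hUT hp), hball q (hUT hq)] using hdisj hp hq hpq
  have hsub : {x ∈ cube c r | K * lam < maxOp f x} ⊆ ⋃ p ∈ U, cube p.1 (5 * p.2) := by
    rintro x ⟨hx, hxK⟩
    obtain ⟨c', r', hr', hx', h⟩ := lt_maxOp_iff.1 hxK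
    have hT : (c', r') ∈ T :=
      ⟨hr', radius_lt_of_lt_average hr' hx hx' hK h, ⟨x, hx, hx'⟩, h⟩
    obtain ⟨p, hp, hsubp⟩ := hcov _ hT
    refine mem_iUnion₂.2 ⟨p, hp, ?_⟩
    rw [cube_eq_closedBall _ (by linarith [(hUT hp).1])]
    apply hsubp
    rwa [← hball _ hT]
  have hunion : (⋃ p ∈ U, cube p.1 p.2) ⊆ cube c (3 * r) := by
    refine iUnion₂_subset fun p hp => ?_
    obtain ⟨-, hpr, ⟨x, hx, hxp⟩, -⟩ := hUT hp
    exact cube_subset_cube_three_mul hxp hx hpr.le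
  have hint : (∫⁻ y in cube c (3 * r), ENNReal.ofReal |f y|) ≤ lam * volume (cube c (3 * r)) := by
    rw [← ENNReal.div_le_iff (volume_cube_ne_zero _ (by positivity))
      (volume_cube_ne_top _ (by positivity))]
    exact le_iInf₂ fun y hy => le_maxOp f (by positivity) (cube_mono c (by linarith) hy)
  have hmain : (K * lam) * volume {x ∈ cube c r | K * lam < maxOp f x} ≤
      ENNReal.ofReal (5 ^ n) * (lam * volume (cube c (3 * r))) := by
    calc (K * lam) * volume {x ∈ cube c r | K * lam < maxOp f x}
        ≤ (K * lam) * ∑' p : U, volume (cube p.1.1 (5 * p.1.2)) := by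
          gcongr
          exact (measure_mono hsub).trans (measure_biUnion_le _ hcount _)
      _ = ∑' p : U, ENNReal.ofReal (5 ^ n) * ((K * lam) * volume (cube p.1.1 p.1.2)) := by
          rw [← ENNReal.tsum_mul_left]
          refine tsum_congr fun p => ?_
          rw [volume_cube_mul _ (by norm_num) (hUT p.2).1.le]
          ring
      _ ≤ ∑' p : U, ENNReal.ofReal (5 ^ n) *
            ∫⁻ y in cube p.1.1 p.1.2, ENNReal.ofReal |f y| := by
          refine ENNReal.tsum_le_tsum fun p => ?_
          gcongr
          have h := (hUT p.2).2.2.2.le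
          rwa [ENNReal.le_div_iff_mul_le (Or.inl (volume_cube_ne_zero _ (hUT p.2).1))
            (Or.inl (volume_cube_ne_top _ (hUT p.2).1.le))] at h
      _ = ENNReal.ofReal (5 ^ n) * ∫⁻ y in ⋃ p ∈ U, cube p.1 p.2, ENNReal.ofReal |f y| := by
          rw [ENNReal.tsum_mul_left, lintegral_biUnion hcount
            (fun p hp => measurableSet_cube _ (hUT hp).1.le) hdisj']
      _ ≤ ENNReal.ofReal (5 ^ n) * (lam * volume (cube c (3 * r))) := by
          gcongr
          exact (lintegral_mono_set hunion).trans hint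
  rw [volume_cube_mul c (by norm_num) hr.le] at hmain
  have h15 : ENNReal.ofReal (15 ^ n) = ENNReal.ofReal (5 ^ n) * ENNReal.ofReal (3 ^ n) := by
    rw [← ENNReal.ofReal_mul (by positivity), ← mul_pow]
    norm_num
  rw [← ENNReal.mul_le_mul_iff_right h0 htop, h15]
  calc _ = (K * lam) * volume {x ∈ cube c r | K * lam < maxOp f x} := by ring
    _ ≤ _ := hmain
    _ = _ := by ring

/-- Weak type estimate for `M f` on a cube, normalised by the infimum of `M f` there. -/
lemma weak_type (f : Rn n → ℝ) (c : Rn n) {r : ℝ} (hr : 0 < r) (K : ℝ≥0∞)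
    (h0 : (⨅ y ∈ cube c r, maxOp f y) ≠ 0) (htop : (⨅ y ∈ cube c r, maxOp f y) ≠ ⊤) :
    K * volume {x ∈ cube c r | K * (⨅ y ∈ cube c r, maxOp f y) < maxOp f x} ≤
      ENNReal.ofReal (15 ^ n) * volume (cube c r) := by
  rcases le_total (ENNReal.ofReal (3 ^ n)) K with hK | hK
  · exact weak_type_large f c hr hK h0 htop
  · refine mul_le_mul' (hK.trans (ENNReal.ofReal_le_ofReal ?_)) (measure_mono (sep_subset _ _))
    exact pow_le_pow_left₀ (by norm_num) (by norm_num) n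

lemma iInf_maxOp_ne_zero {f : Rn n → ℝ} {x : Rn n} (hx : 0 < maxOp f x) (c : Rn n) {r : ℝ}
    (hr : 0 < r) : (⨅ y ∈ cube c r, maxOp f y) ≠ 0 := by
  obtain ⟨c', r', hr', -, h⟩ := lt_maxOp_iff.1 hx
  let s := dist c' c + r + r'
  have hs : 0 < s := by positivity
  have hsub : cube c' r' ⊆ cube c s := by
    intro y hy
    rw [cube_eq_closedBall _ hr'.le] at hy
    rw [cube_eq_closedBall _ hs.le]
    refine Metric.closedBall_subset_closedBall' ?_ hy
    simp only [s]
    linarith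
  have hle : (∫⁻ y in cube c s, ENNReal.ofReal |f y|) / volume (cube c s) ≤
      ⨅ y ∈ cube c r, maxOp f y := by
    refine le_iInf₂ fun y hy => le_maxOp f hs (cube_mono c ?_ hy)
    have := dist_nonneg (x := c') (y := c)
    simp only [s]
    linarith
  refine (lt_of_lt_of_le ?_ hle).ne'
  refine ENNReal.div_pos (fun h0 => ?_) (volume_cube_ne_top c hs.le)
  have : (∫⁻ y in cube c' r', ENNReal.ofReal |f y|) = 0 :=
    nonpos_iff_eq_zero.1 ((lintegral_mono_set hsub).trans h0.le)
  simp [this] at h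

lemma exists_mem_cube_of_ae {p : Rn n → Prop} (h : ∀ᵐ x, p x) (c : Rn n) {r : ℝ} (hr : 0 < r) :
    ∃ x ∈ cube c r, p x := by
  by_contra! hne
  exact volume_cube_ne_zero c hr (measure_mono_null (fun x hx => hne x hx) (ae_iff.1 h))

lemma iInf_maxOp_ne_top {f : Rn n → ℝ} (hf : ∀ᵐ x, maxOp f x < ⊤) (c : Rn n) {r : ℝ}
    (hr : 0 < r) : (⨅ y ∈ cube c r, maxOp f y) ≠ ⊤ := by
  obtain ⟨x, hx, hfx⟩ := exists_mem_cube_of_ae hf c hr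
  exact ((iInf₂_le x hx).trans_lt hfx).ne

end Cubes

section Products

variable {n N : ℕ}

/-- The weight `∏ j, (M h_j) ^ (-α_j)`. -/
def maxProd (α : Fin N → ℝ) (h : Fin N → Rn n → ℝ) (x : Rn n) : ℝ :=
  ∏ j, (maxOp (h j) x).toReal ^ (-α j)

lemma measurable_maxProd (α : Fin N → ℝ) (h : Fin N → Rn n → ℝ) : Measurable (maxProd α h) :=
  Finset.measurable_fun_prod _ fun j _ => (measurable_maxOp (h j)).ennreal_toReal.pow_const _

lemma maxProd_nonneg (α : Fin N → ℝ) (h : Fin N → Rn n → ℝ) (x : Rn n) : 0 ≤ maxProd α h x :=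
  Finset.prod_nonneg fun _ _ => Real.rpow_nonneg ENNReal.toReal_nonneg _

lemma ae_maxProd_pos {α : Fin N → ℝ} {h : Fin N → Rn n → ℝ}
    (hM : ∀ j, ∀ᵐ x : Rn n ∂volume, 0 < maxOp (h j) x ∧ maxOp (h j) x < ⊤) :
    ∀ᵐ x, 0 < maxProd α h x := by
  filter_upwards [ae_all_iff.2 hM] with x hx
  exact Finset.prod_pos fun j _ =>
    Real.rpow_pos_of_pos (ENNReal.toReal_pos (hx j).1.ne' (hx j).2.ne) _

/-- On a cube, `∏ j, (M h_j) ^ (-α_j)` is bounded, and is seldom much smaller than its bound. -/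
lemma exists_maxProd_bound {α : Fin N → ℝ} (hα : ∀ j, 0 ≤ α j) {h : Fin N → Rn n → ℝ}
    (hM : ∀ j, ∀ᵐ x : Rn n ∂volume, 0 < maxOp (h j) x ∧ maxOp (h j) x < ⊤)
    (c : Rn n) {r : ℝ} (hr : 0 < r) :
    ∃ L : ℝ, 0 < L ∧ (∀ᵐ x, x ∈ cube c r → maxProd α h x ≤ L) ∧
      ∀ K : ℝ, 1 ≤ K →
        ENNReal.ofReal K * volume {x ∈ cube c r | maxProd α h x < K ^ (-∑ j, α j) * L} ≤
          N * ENNReal.ofReal (15 ^ n) * volume (cube c r) := by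
  set lam : Fin N → ℝ≥0∞ := fun j => ⨅ y ∈ cube c r, maxOp (h j) y with hlam
  have hlam0 : ∀ j, lam j ≠ 0 := fun j => by
    obtain ⟨x, -, hx⟩ := exists_mem_cube_of_ae (hM j) c hr
    exact iInf_maxOp_ne_zero hx.1 c hr
  have hlamtop : ∀ j, lam j ≠ ⊤ := fun j => iInf_maxOp_ne_top ((hM j).mono fun _ h => h.2) c hr
  have hpos : ∀ j, 0 < (lam j).toReal := fun j => ENNReal.toReal_pos (hlam0 j) (hlamtop j)
  refine ⟨∏ j, (lam j).toReal ^ (-α j), Finset.prod_pos fun j _ =>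
    Real.rpow_pos_of_pos (hpos j) _, ?_, ?_⟩
  · filter_upwards [ae_all_iff.2 hM] with x hx hxc
    refine Finset.prod_le_prod (fun j _ => Real.rpow_nonneg ENNReal.toReal_nonneg _) fun j _ => ?_
    refine Real.rpow_le_rpow_of_nonpos (hpos j) ?_ (neg_nonpos.2 (hα j))
    exact ENNReal.toReal_mono (hx j).2.ne (iInf₂_le x hxc)
  · intro K hK
    have hK0 : 0 < K := by linarith
    have hle : volume {x ∈ cube c r | maxProd α h x <
        K ^ (-∑ j, α j) * ∏ j, (lam j).toReal ^ (-α j)} ≤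
        volume (⋃ j, {x ∈ cube c r | ENNReal.ofReal K * lam j < maxOp (h j) x}) := by
      refine measure_mono_ae ?_
      filter_upwards [ae_all_iff.2 hM] with x hx
      rintro ⟨hxc, hlt⟩
      refine mem_iUnion.2 ?_
      by_contra! hne
      refine hlt.not_ge ?_
      rw [← Finset.sum_neg_distrib, Real.rpow_sum_of_pos hK0, ← Finset.prod_mul_distrib]
      refine Finset.prod_le_prod (fun j _ => by have := hpos j; positivity) fun j _ => ?_
      rw [← Real.mul_rpow hK0.le (hpos j).le]
      refine Real.rpow_le_rpow_of_nonpos (ENNReal.toReal_pos (hx j).1.ne' (hx j).2.ne) ?_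
        (neg_nonpos.2 (hα j))
      have hj : maxOp (h j) x ≤ ENNReal.ofReal K * lam j := by
        by_contra! hcon
        exact hne j ⟨hxc, hcon⟩
      have := ENNReal.toReal_mono (ENNReal.mul_ne_top ENNReal.ofReal_ne_top (hlamtop j)) hj
      rwa [ENNReal.toReal_mul, ENNReal.toReal_ofReal hK0.le] at this
    calc _ ≤ ENNReal.ofReal K *
          ∑ j, volume {x ∈ cube c r | ENNReal.ofReal K * lam j < maxOp (h j) x} := by
          gcongr
          exact hle.trans (measure_iUnion_fintype_le _ _)
      _ ≤ ∑ _j : Fin N, ENNReal.ofReal (15 ^ n) * volume (cube c r) := by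
          rw [Finset.mul_sum]
          exact Finset.sum_le_sum fun j _ => weak_type (h j) c hr _ (hlam0 j) (hlamtop j)
      _ = _ := by simp [mul_assoc]

lemma isWeight_maxProd {α : Fin N → ℝ} (hα : ∀ j, 0 ≤ α j) {h : Fin N → Rn n → ℝ}
    (hM : ∀ j, ∀ᵐ x : Rn n ∂volume, 0 < maxOp (h j) x ∧ maxOp (h j) x < ⊤) :
    IsWeight (maxProd α h) := by
  refine ⟨fun x => ?_, ae_maxProd_pos hM⟩
  obtain ⟨L, -, hL, -⟩ := exists_maxProd_bound hα hM x one_pos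
  refine ⟨cube x 1, ?_, ?_⟩
  · rw [cube_eq_closedBall x zero_le_one]
    exact Metric.closedBall_mem_nhds x one_pos
  · refine Measure.integrableOn_of_bounded (M := L) (volume_cube_ne_top x zero_le_one)
      (measurable_maxProd α h).aestronglyMeasurable ?_
    rw [ae_restrict_iff' (measurableSet_cube x zero_le_one)]
    filter_upwards [hL] with y hy hyx
    rw [Real.norm_of_nonneg (maxProd_nonneg α h y)]
    exact hy hyx

/-- The bound for the `RH∞` constant of `∏ j, (M h_j) ^ (-α_j)`. -/
def rhBound (n N : ℕ) (s : ℝ) : ℝ := 2 * (2 * N * 15 ^ n + 1) ^ s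

lemma RHinfConst_maxProd_le {α : Fin N → ℝ} (hα : ∀ j, 0 ≤ α j) {h : Fin N → Rn n → ℝ}
    (hM : ∀ j, ∀ᵐ x : Rn n ∂volume, 0 < maxOp (h j) x ∧ maxOp (h j) x < ⊤) :
    RHinfConst (maxProd α h) ≤ ENNReal.ofReal (rhBound n N (∑ j, α j)) := by
  refine iSup_le fun c => iSup_le fun r => iSup_le fun hr => ?_
  obtain ⟨L, hL0, hL, hD⟩ := exists_maxProd_bound hα hM c hr
  set s := ∑ j, α j
  set K : ℝ := 2 * N * 15 ^ n + 1 with hKdef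
  have hK : 1 ≤ K := by
    have : (0 : ℝ) ≤ 2 * N * 15 ^ n := by positivity
    linarith
  have hK0 : 0 < K := by linarith
  set Q := cube c r
  have hQm : MeasurableSet Q := measurableSet_cube c hr.le
  have hQtop : volume Q ≠ ⊤ := volume_cube_ne_top c hr.le
  set B := {x ∈ Q | maxProd α h x < K ^ (-s) * L}
  have hBm : MeasurableSet B :=
    hQm.inter (measurableSet_lt (measurable_maxProd α h) measurable_const)
  have hBtop : volume B ≠ ⊤ := measure_ne_top_of_subset (sep_subset _ _) hQtop
  have hB : 2 * volume B ≤ volume Q := by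
    have h1 := hD K hK
    have h2 : ENNReal.ofReal K * (2 * volume B) ≤ ENNReal.ofReal K * volume Q := by
      calc ENNReal.ofReal K * (2 * volume B) = 2 * (ENNReal.ofReal K * volume B) := by ring
        _ ≤ 2 * (N * ENNReal.ofReal (15 ^ n) * volume Q) := by gcongr
        _ = ENNReal.ofReal (2 * N * 15 ^ n) * volume Q := by
            rw [ENNReal.ofReal_mul (by positivity), ENNReal.ofReal_mul (by positivity)]
            simp [mul_assoc]
        _ ≤ ENNReal.ofReal K * volume Q := by
            gcongr
            linarith
    exact (ENNReal.mul_le_mul_iff_right (by simpa using hK0) ENNReal.ofReal_ne_top).1 h2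
  have hgood : volume Q ≤ 2 * volume (Q \ B) := by
    have h1 : volume Q = volume B + volume (Q \ B) := by
      rw [← measure_inter_add_sdiff Q hBm, inter_eq_right.2 (sep_subset _ _)]
    have h2 : volume B ≤ volume (Q \ B) := by
      refine (ENNReal.add_le_add_iff_left hBtop).1 ?_
      rw [← h1, ← two_mul]
      exact hB
    rw [h1, two_mul]
    gcongr
  have hmass : ENNReal.ofReal (K ^ (-s) * L) * volume (Q \ B) ≤ wMeasure (maxProd α h) Q := by
    rw [wMeasure, withDensity_apply _ hQm]
    refine le_trans ?_ (lintegral_mono_set (sdiff_subset (s := Q) (t := B)))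
    rw [← setLIntegral_const]
    refine setLIntegral_mono' (hQm.diff hBm) fun x hx => ENNReal.ofReal_le_ofReal ?_
    by_contra! hlt
    exact hx.2 ⟨hx.1, hlt⟩
  have hess : essSup (fun x => ENNReal.ofReal (maxProd α h x)) (volume.restrict Q) ≤
      ENNReal.ofReal L := by
    refine essSup_le_of_ae_le _ ?_
    rw [EventuallyLE, ae_restrict_iff' hQm]
    filter_upwards [hL] with x hx hxQ
    exact ENNReal.ofReal_le_ofReal (hx hxQ)
  refine ENNReal.div_le_of_le_mul ?_
  calc _ ≤ ENNReal.ofReal L * (2 * volume (Q \ B)) := by gcongr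
    _ = ENNReal.ofReal (rhBound n N s) * (ENNReal.ofReal (K ^ (-s) * L) * volume (Q \ B)) := by
        have : ENNReal.ofReal (rhBound n N s) * ENNReal.ofReal (K ^ (-s) * L) =
            ENNReal.ofReal L * 2 := by
          rw [← ENNReal.ofReal_mul (by unfold rhBound; positivity), ← ENNReal.ofReal_ofNat 2,
            ← ENNReal.ofReal_mul hL0.le, rhBound, ← hKdef]
          congr 1
          rw [Real.rpow_neg hK0.le]
          have := (Real.rpow_pos_of_pos hK0 s).ne'
          field_simp
        rw [← mul_assoc, ← mul_assoc, this]
    _ ≤ _ := by gcongr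

/-- A function whose distribution function decays quadratically is integrable. -/
lemma lintegral_le_of_distribution {X : Type*} [MeasurableSpace X] {μ : Measure X}
    {G : X → ℝ≥0∞} (hG : Measurable G) {b : ℝ≥0∞}
    (h : ∀ k : ℕ, 4 ^ k * μ {x | 2 ^ k < G x} ≤ b) :
    ∫⁻ x, G x ∂μ ≤ μ univ + 4 * b := by
  have hmeas : ∀ k : ℕ, MeasurableSet {x | (2 : ℝ≥0∞) ^ k < G x} :=
    fun k => measurableSet_lt measurable_const hG
  have hpt : ∀ x, G x ≤ 1 + ∑' k : ℕ, {x | (2 : ℝ≥0∞) ^ k < G x}.indicator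
      (fun _ => 2 ^ (k + 1)) x := by
    intro x
    have hterm : ∀ k : ℕ, 2 ^ k < G x → (2 : ℝ≥0∞) ^ (k + 1) ≤
        ∑' k : ℕ, {x | (2 : ℝ≥0∞) ^ k < G x}.indicator (fun _ => 2 ^ (k + 1)) x := fun k hk =>
      le_of_eq_of_le (indicator_of_mem (s := {x | (2 : ℝ≥0∞) ^ k < G x}) hk
        fun _ => 2 ^ (k + 1)).symm (ENNReal.le_tsum k)
    by_cases hex : ∃ k : ℕ, G x ≤ 2 ^ k
    · classical
      rcases hk : Nat.find hex with _ | k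
      · have h0 := Nat.find_spec hex
        rw [hk, pow_zero] at h0
        exact h0.trans le_self_add
      · have h1 := Nat.find_spec hex
        rw [hk] at h1
        have h2 := Nat.find_min hex (m := k) (by omega)
        exact h1.trans ((hterm k (not_le.1 h2)).trans le_add_self)
    · push Not at hex
      refine le_of_le_of_eq le_top ?_
      by_contra hne
      obtain ⟨k, hk⟩ := ENNReal.exists_nat_gt (Ne.symm hne)
      refine hk.not_ge (le_trans ?_ ((hterm k (hex k)).trans le_add_self))
      exact_mod_cast (Nat.lt_two_pow_self.trans (Nat.pow_lt_pow_succ one_lt_two)).le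
  calc ∫⁻ x, G x ∂μ ≤ ∫⁻ x, 1 + ∑' k : ℕ, {x | (2 : ℝ≥0∞) ^ k < G x}.indicator
        (fun _ => 2 ^ (k + 1)) x ∂μ := lintegral_mono hpt
    _ = μ univ + ∑' k : ℕ, 2 ^ (k + 1) * μ {x | 2 ^ k < G x} := by
        rw [lintegral_add_left measurable_const, lintegral_one, lintegral_tsum
          fun k => (measurable_const.indicator (hmeas k)).aemeasurable]
        congr 1
        exact tsum_congr fun k => lintegral_indicator_const (hmeas k) _
    _ ≤ μ univ + ∑' k : ℕ, 2 * b * (2⁻¹ ^ k) := by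
        refine add_le_add_right (ENNReal.tsum_le_tsum fun k => ?_) _
        have h4 : (4 : ℝ≥0∞) ^ k = 2 ^ k * 2 ^ k := by rw [← mul_pow]; norm_num
        have h2 : (2 : ℝ≥0∞) ^ k * 2⁻¹ ^ k = 1 := by
          rw [← mul_pow, ENNReal.mul_inv_cancel (by norm_num) (by norm_num), one_pow]
        calc (2 : ℝ≥0∞) ^ (k + 1) * μ {x | 2 ^ k < G x}
            = 2 * (2 ^ k * μ {x | 2 ^ k < G x}) * (2 ^ k * 2⁻¹ ^ k) := by
              rw [h2, pow_succ]; ring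
          _ = 2 * (4 ^ k * μ {x | 2 ^ k < G x}) * 2⁻¹ ^ k := by rw [h4]; ring
          _ ≤ 2 * b * 2⁻¹ ^ k := by gcongr; exact h k
    _ = μ univ + 4 * b := by
        rw [ENNReal.tsum_mul_left, ENNReal.tsum_geometric, ENNReal.one_sub_inv_two, inv_inv]
        ring

end Products

section Aq

variable {n N : ℕ}

/-- A small negative power of `∏ j, (M h_j) ^ (-α_j)` has average over a cube comparable to the
same power of an upper bound for the product on that cube. -/
lemma exists_maxProd_average_bound {α : Fin N → ℝ} (hα : ∀ j, 0 ≤ α j) {h : Fin N → Rn n → ℝ}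
    (hM : ∀ j, ∀ᵐ x : Rn n ∂volume, 0 < maxOp (h j) x ∧ maxOp (h j) x < ⊤)
    {S : ℝ} (hS : ∑ j, α j ≤ S) (hS0 : 0 < S) (c : Rn n) {r : ℝ} (hr : 0 < r) :
    ∃ L : ℝ, 0 < L ∧ (∀ᵐ x, x ∈ cube c r → maxProd α h x ≤ L) ∧
      ∫⁻ x in cube c r, ENNReal.ofReal ((maxProd α h x / L) ^ (-(1 / (2 * S)))) ≤
        (1 + 4 * (N * ENNReal.ofReal (15 ^ n))) * volume (cube c r) := by
  obtain ⟨L, hL0, hL, hD⟩ := exists_maxProd_bound hα hM c hr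
  refine ⟨L, hL0, hL, ?_⟩
  have hmeas : Measurable fun x => ENNReal.ofReal ((maxProd α h x / L) ^ (-(1 / (2 * S)))) :=
    (((measurable_maxProd α h).div_const L).pow_const _).ennreal_ofReal
  refine (lintegral_le_of_distribution hmeas (b := N * ENNReal.ofReal (15 ^ n) *
    volume (cube c r)) fun k => ?_).trans (le_of_eq ?_)
  · have hK : (1 : ℝ) ≤ 4 ^ k := one_le_pow₀ (by norm_num)
    have hK0 : (0 : ℝ) < 4 ^ k := by positivity
    refine le_trans ?_ (hD (4 ^ k) hK)
    rw [Measure.restrict_apply (measurableSet_lt measurable_const hmeas),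
      ENNReal.ofReal_pow (by norm_num), ENNReal.ofReal_ofNat]
    gcongr
    rintro x ⟨hx, hxc⟩
    rw [mem_ofPred_eq] at hx
    refine ⟨hxc, ?_⟩
    by_contra! hge
    refine hx.not_ge ?_
    rw [← ENNReal.ofReal_ofNat 2, ← ENNReal.ofReal_pow (by norm_num)]
    refine ENNReal.ofReal_le_ofReal ?_
    have h1 : ((4 : ℝ) ^ k) ^ (-S) ≤ maxProd α h x / L := by
      rw [le_div_iff₀ hL0]
      refine le_trans ?_ hge
      gcongr
    calc (maxProd α h x / L) ^ (-(1 / (2 * S)))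
        ≤ (((4 : ℝ) ^ k) ^ (-S)) ^ (-(1 / (2 * S))) :=
          Real.rpow_le_rpow_of_nonpos (Real.rpow_pos_of_pos hK0 _) h1
            (neg_nonpos.2 (by positivity))
      _ = ((4 : ℝ) ^ k) ^ (1 / 2 : ℝ) := by
          rw [← Real.rpow_mul hK0.le]
          congr 1
          field_simp
      _ = 2 ^ k := by
          rw [← Real.sqrt_eq_rpow, show (4 : ℝ) ^ k = (2 ^ k) ^ 2 by
            rw [← pow_mul, mul_comm, pow_mul]; norm_num]
          exact Real.sqrt_sq (by positivity)
  · rw [Measure.restrict_apply_univ]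
    ring

lemma MemA1.exists_lower_bound {u : Rn n → ℝ} (hu : MemA1 u) :
    ∃ C : ℝ, 0 < C ∧ ∀ (c : Rn n) (r : ℝ), 0 < r → ∃ a : ℝ, 0 < a ∧
      ∫⁻ x in cube c r, ENNReal.ofReal (u x) = ENNReal.ofReal a * volume (cube c r) ∧
      ∀ᵐ x, x ∈ cube c r → a / C ≤ u x := by
  obtain ⟨⟨hloc, hpos⟩, hfin⟩ := hu
  obtain ⟨C, hC, hCtop⟩ := sInf_lt_iff.1 hfin
  refine ⟨C.toReal + 1, by positivity, fun c r hr => ?_⟩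
  have hQm := measurableSet_cube c hr.le
  have hvol0 := volume_cube_ne_zero c hr
  have hvoltop := volume_cube_ne_top c hr.le
  have habs : ∫⁻ x in cube c r, ENNReal.ofReal |u x| =
      ∫⁻ x in cube c r, ENNReal.ofReal (u x) := by
    refine lintegral_congr_ae (ae_restrict_of_ae ?_)
    filter_upwards [hpos] with x hx
    rw [abs_of_pos hx]
  have hint : IntegrableOn u (cube c r) := by
    refine hloc.integrableOn_isCompact ?_
    rw [cube_eq_closedBall c hr.le]
    exact isCompact_closedBall c r
  have htop : ∫⁻ x in cube c r, ENNReal.ofReal (u x) ≠ ⊤ := hint.lintegral_lt_top.ne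
  have h0 : ∫⁻ x in cube c r, ENNReal.ofReal (u x) ≠ 0 := by
    intro h
    rw [lintegral_eq_zero_iff' hint.aemeasurable.ennreal_ofReal, EventuallyEq,
      ae_restrict_iff' hQm] at h
    obtain ⟨x, hx, h1, h2⟩ := exists_mem_cube_of_ae (h.and hpos) c hr
    have := h1 hx
    simp only [Pi.zero_apply, ENNReal.ofReal_eq_zero] at this
    linarith
  set A := (∫⁻ x in cube c r, ENNReal.ofReal (u x)) / volume (cube c r) with hA
  have hA0 : A ≠ 0 := (ENNReal.div_pos h0 hvoltop).ne'
  have hAtop : A ≠ ⊤ := ENNReal.div_ne_top htop hvol0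
  refine ⟨A.toReal, ENNReal.toReal_pos hA0 hAtop, ?_, ?_⟩
  · rw [ENNReal.ofReal_toReal hAtop, hA, ENNReal.div_mul_cancel hvol0 hvoltop]
  · filter_upwards [hC, hpos] with x hx hux hxc
    rw [div_le_iff₀ (by positivity)]
    have h1 : A ≤ C * ENNReal.ofReal (u x) := by
      rw [hA, ← habs]
      exact (le_maxOp u hr hxc).trans hx
    have h2 := ENNReal.toReal_mono (ENNReal.mul_ne_top hCtop.ne ENNReal.ofReal_ne_top) h1
    rw [ENNReal.toReal_mul, ENNReal.toReal_ofReal hux.le] at h2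
    nlinarith

lemma memAinf_mul_maxProd {α : Fin N → ℝ} (hα : ∀ j, 0 ≤ α j) {h : Fin N → Rn n → ℝ}
    (hM : ∀ j, ∀ᵐ x : Rn n ∂volume, 0 < maxOp (h j) x ∧ maxOp (h j) x < ⊤)
    {u : Rn n → ℝ} (hu : MemA1 u) : MemAinf fun x => u x * maxProd α h x := by
  set S := ∑ j, α j + 1
  have hS : 0 < S := by
    have := Finset.sum_nonneg fun j (_ : j ∈ Finset.univ) => hα j
    positivity
  obtain ⟨C, hC, hCu⟩ := hu.exists_lower_bound
  set D : ℝ≥0∞ := 1 + 4 * (N * ENNReal.ofReal (15 ^ n))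
  have hDtop : D ≠ ⊤ := by simp [D, ENNReal.mul_eq_top]
  refine ⟨1 + 2 * S, by linarith, lt_of_le_of_lt (b := ENNReal.ofReal C * D ^ (2 * S)) ?_
    (ENNReal.mul_lt_top ENNReal.ofReal_lt_top
      (ENNReal.rpow_lt_top_of_nonneg (by positivity) hDtop))⟩
  refine iSup_le fun c => iSup_le fun r => iSup_le fun hr => ?_
  obtain ⟨L, hL0, hL, hint⟩ := exists_maxProd_average_bound hα hM (S := S) (by simp [S]) hS c hr
  obtain ⟨a, ha, hau, hlow⟩ := hCu c r hr
  have hQm := measurableSet_cube c hr.le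
  have hvol0 := volume_cube_ne_zero c hr
  have hvoltop := volume_cube_ne_top c hr.le
  have hexp : 1 - (1 + 2 * S) / (1 + 2 * S - 1) = -(1 / (2 * S)) := by
    rw [add_sub_cancel_left]
    field_simp
    ring
  have hm : 0 < a / C := div_pos ha hC
  have h1 : wMeasure (fun x => u x * maxProd α h x) (cube c r) / volume (cube c r) ≤
      ENNReal.ofReal (L * a) := by
    rw [ENNReal.div_le_iff hvol0 hvoltop, wMeasure, withDensity_apply _ hQm,
      ENNReal.ofReal_mul hL0.le, mul_assoc, ← hau, ← lintegral_const_mul' _ _ ENNReal.ofReal_ne_top]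
    refine lintegral_mono_ae ?_
    rw [ae_restrict_iff' hQm]
    filter_upwards [hL, hu.1.2] with x hx hux hxc
    rw [← ENNReal.ofReal_mul hL0.le, mul_comm]
    gcongr
    exact hx hxc
  have h2 : (∫⁻ x in cube c r, ENNReal.ofReal ((u x * maxProd α h x) ^ (-(1 / (2 * S))))) /
      volume (cube c r) ≤ ENNReal.ofReal ((a / C * L) ^ (-(1 / (2 * S)))) * D := by
    rw [ENNReal.div_le_iff hvol0 hvoltop, mul_assoc]
    refine le_trans ?_ (mul_le_mul_right hint _)
    rw [← lintegral_const_mul' _ _ ENNReal.ofReal_ne_top]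
    refine lintegral_mono_ae ?_
    rw [ae_restrict_iff' hQm]
    filter_upwards [hlow, ae_maxProd_pos (α := α) hM] with x hux hv hxc
    rw [← ENNReal.ofReal_mul (by positivity), ← Real.mul_rpow (by positivity) (by positivity)]
    refine ENNReal.ofReal_le_ofReal (Real.rpow_le_rpow_of_nonpos (by positivity) ?_
      (neg_nonpos.2 (by positivity)))
    rw [mul_assoc, mul_div_cancel₀ _ hL0.ne']
    gcongr
    exact hux hxc
  rw [hexp, add_sub_cancel_left]
  calc _ ≤ ENNReal.ofReal (L * a) *
        (ENNReal.ofReal ((a / C * L) ^ (-(1 / (2 * S)))) * D) ^ (2 * S) := by gcongr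
    _ = ENNReal.ofReal C * D ^ (2 * S) := by
        rw [ENNReal.mul_rpow_of_nonneg _ _ (by positivity), ← mul_assoc,
          ENNReal.ofReal_rpow_of_nonneg (by positivity) (by positivity),
          ← Real.rpow_mul (by positivity), ← ENNReal.ofReal_mul (by positivity)]
        congr 2
        rw [show -(1 / (2 * S)) * (2 * S) = -1 by field_simp, Real.rpow_neg_one]
        field_simp

end Aq

/-- If `w = u ∏_{j=1}^N (Mh_j)^{-α_j}` with `u ∈ A₁`, `h_j ∈ L¹_loc`, `0 < Mh_j < ∞` a.e.
and `α_j ≥ 0`, then `w ∈ A∞` and `[w]_{RH∞¹} ≲ [u]_{A₁}`, with implicit constant depending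
only on `n`, `N` and the exponents `α_j`. -/
theorem stmt6 (n N : ℕ) (α : Fin N → ℝ) (hα : ∀ j, 0 ≤ α j) :
    ∃ C : ℝ≥0∞, C < ⊤ ∧ ∀ (u : Rn n → ℝ) (h : Fin N → Rn n → ℝ), MemA1 u →
      (∀ j, LocallyIntegrable (h j) volume) →
      (∀ j, ∀ᵐ x : Rn n ∂volume, 0 < maxOp (h j) x ∧ maxOp (h j) x < ⊤) →
      MemAinf (fun x => u x * ∏ j, (maxOp (h j) x).toReal ^ (-α j)) ∧
      RH1Const (fun x => u x * ∏ j, (maxOp (h j) x).toReal ^ (-α j)) ≤ C * A1Const u := by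
  refine ⟨ENNReal.ofReal (rhBound n N (∑ j, α j)), ENNReal.ofReal_lt_top, fun u h hu _ hM =>
    ⟨memAinf_mul_maxProd hα hM hu, ?_⟩⟩
  have hRH := RHinfConst_maxProd_le hα hM
  have hle : RH1Const (fun x => u x * ∏ j, (maxOp (h j) x).toReal ^ (-α j)) ≤
      A1Const u * RHinfConst (maxProd α h) :=
    sInf_le ⟨u, maxProd α h, fun _ => rfl, hu, isWeight_maxProd hα hM,
      hRH.trans_lt ENNReal.ofReal_lt_top, rfl⟩
  refine hle.trans ?_
  rw [mul_comm]
  gcongr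
end
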